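/- Assume Setup (T). Then for all n ∈ ℤ, p^m · (P∗(P∗P^n)) = n·p^m · (P∗(P∗P)) = 0, and moreover P^{p^m} = p^m · P (the p^m-th ∘-power of P equals the p^m-fold additive multiple of P). -/

import Mathlib

/-- A (left) brace: an abelian group `(A,+)` and a group `(A,∘)` (written `*`)
on the same underlying set, with `a∘(b+c)+a = a∘b+a∘c`; the identity of `(A,∘)`
coincides with `0`. -/
class Brace (A : Type*) extends AddCommGroup A, Group A where
  mul_add_left : ∀ a b c : A, a * (b + c) + a = a * b + a * c
  one_eq_zero : (1 : A) = 0

namespace Brace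

variable {A : Type*} [Brace A]

/-- The star operation `a ∗ b = a∘b - a - b`. -/
def bstar (a b : A) : A := a * b - a - b

/-- `X ∗ Y`: the additive subgroup generated by `{x∗y : x ∈ X, y ∈ Y}`. -/
def starSpan (A : Type*) [Brace A] (X Y : Set A) : AddSubgroup A :=
  AddSubgroup.closure {z : A | ∃ x ∈ X, ∃ y ∈ Y, z = bstar x y}

/-- `A² = A ∗ A`. -/
def sq (A : Type*) [Brace A] : AddSubgroup A := starSpan A Set.univ Set.univ

/-- `A³ = A ∗ A²`. -/
def cube (A : Type*) [Brace A] : AddSubgroup A := starSpan A Set.univ (sq A : Set A)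

/-- The right series: `rightSeries A 0 = A^(1) = A`, `rightSeries A (n+1) = A^(n+1+1) = A^(n+1) ∗ A`. -/
def rightSeries (A : Type*) [Brace A] : ℕ → AddSubgroup A
  | 0 => ⊤
  | n + 1 => starSpan A (rightSeries A n : Set A) Set.univ

/-- A brace is right nilpotent if `A^(n) = 0` for some `n`. -/
def RightNilpotent (A : Type*) [Brace A] : Prop := ∃ n : ℕ, rightSeries A n = ⊥

/-- `c ∈ Z(A)`: `c∗a = a∗c` for all `a`. -/
def IsCentral (c : A) : Prop := ∀ a : A, bstar c a = bstar a c

end Brace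

/-- Setup (T) of the paper: `p > 5` prime, `A` a brace of cardinality `p^4` whose additive
group is `C_p × C_{p^3}` (with `m = 2`) or `C_{p^2} × C_{p^2}` (with `m = 1`), whose
multiplicative group is generated by `{P, Q_1, …, Q_i}`, with `P^{p^m}` central and in `A²`,
each `Q_j` of order at most `p^m`, and every `a ∈ A` writable as
`P^k ∘ Q_{σ(1)}^{a_{σ(1)}} ∘ ⋯ ∘ Q_{σ(i)}^{a_{σ(i)}}` for every ordering `σ`. -/
structure SetupT (p m i : ℕ) (A : Type*) [Brace A] (P : A) (Q : Fin i → A) : Prop where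
  hp : p.Prime
  hp5 : 5 < p
  hcard : Nat.card A = p ^ 4
  hadd : (Nonempty (A ≃+ ZMod p × ZMod (p ^ 3)) ∧ m = 2) ∨
         (Nonempty (A ≃+ ZMod (p ^ 2) × ZMod (p ^ 2)) ∧ m = 1)
  hgen : Subgroup.closure ({P} ∪ Set.range Q) = ⊤
  hcentral : Brace.IsCentral (P ^ (p ^ m))
  hsq : P ^ (p ^ m) ∈ Brace.sq A
  hord : ∀ j : Fin i, orderOf (Q j) ≤ p ^ m
  hdecomp : ∀ a : A, ∀ σ : Equiv.Perm (Fin i), ∃ (k : ℤ) (e : Fin i → ℤ),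
      a = P ^ k * (List.ofFn fun t : Fin i => Q (σ t) ^ e (σ t)).prod

namespace Brace

variable {A : Type*} [Brace A]

/-- The action `λ_a b = a∘b - a` of `(A,∘)` on `(A,+)`. -/
def lam (a : A) : AddMonoid.End A :=
  AddMonoidHom.mk' (fun b => a * b - a) (fun b c => by
    have h := mul_add_left a b c
    rw [← eq_sub_iff_add_eq] at h
    rw [h]; abel)

lemma lam_apply (a b : A) : lam a b = a * b - a := rfl

lemma mul_eq_add_lam (a b : A) : a * b = a + lam a b := by
  rw [lam_apply]; abel

lemma lam_mul (a b : A) : lam (a * b) = lam a * lam b := by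
  ext c
  have h : a * (b * c) = a * b + lam a (lam b c) := by
    rw [mul_eq_add_lam b c, mul_eq_add_lam a (b + _), map_add, mul_eq_add_lam a b]; abel
  change a * b * c - a * b = lam a (lam b c)
  rw [mul_assoc, h]; abel

lemma lam_one : lam (1 : A) = 1 := by
  ext c
  rw [lam_apply, one_mul, one_eq_zero, sub_zero]; rfl

lemma lam_pow (a : A) (n : ℕ) : lam (a ^ n) = lam a ^ n := by
  induction n with
  | zero => rw [pow_zero, pow_zero, lam_one]
  | succ n ih => rw [pow_succ, pow_succ, lam_mul, ih]

/-- The additive endomorphism `b ↦ a ∗ b`. -/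
def starHom (a : A) : AddMonoid.End A := lam a - 1

lemma starHom_apply (a b : A) : starHom a b = bstar a b := rfl

lemma mul_eq_add_starHom (a b : A) : a * b = a + b + starHom a b := by
  rw [starHom_apply, bstar]; abel

/-- A left ideal of a brace, regarded as a subgroup of `(A,∘)`. -/
def subgroupOfLamInvariant (B : AddSubgroup A) (hB : ∀ a, ∀ b ∈ B, lam a b ∈ B) : Subgroup A where
  carrier := B
  mul_mem' {a b} ha hb := by
    rw [mul_eq_add_lam]
    exact B.add_mem ha (hB a b hb)
  one_mem' := by
    rw [one_eq_zero]
    exact B.zero_mem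
  inv_mem' {a} ha := by
    have h : a⁻¹ = -lam a⁻¹ a := by
      rw [lam_apply, inv_mul_cancel, one_eq_zero]; abel
    rw [h]
    exact B.neg_mem (hB _ _ ha)

end Brace

lemma AddMonoid.End.natCast_eq_zero_of_card {G : Type*} [AddCommGroup G] {n : ℕ}
    (h : Nat.card G = n) : (n : AddMonoid.End G) = 0 := by
  ext x
  rw [AddMonoid.End.natCast_apply, ← h, card_nsmul_eq_zero']
  rfl

/-- An endomorphism of a finite abelian `p`-group whose order is a power of `p` is unipotent. -/
lemma AddMonoid.End.isNilpotent_sub_one_of_pow_eq_one {G : Type*} [AddCommGroup G] {p k n : ℕ}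
    (hp : p.Prime) (hG : Nat.card G = p ^ k) {f : AddMonoid.End G} (hf : f ^ p ^ n = 1) :
    IsNilpotent (f - 1) := by
  obtain ⟨r, hr⟩ := (Commute.one_right (f - 1)).exists_add_pow_prime_pow_eq hp n
  rw [sub_add_cancel, hf, one_pow] at hr
  have hN : (f - 1) ^ p ^ n = (p : AddMonoid.End G) * -((f - 1) * 1 * r) := by
    rw [mul_neg, eq_neg_iff_add_eq_zero]
    have h2 := sub_eq_zero.mpr hr.symm
    rw [← h2]
    simp only [mul_assoc]
    abel
  refine ⟨p ^ n * k, ?_⟩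
  rw [pow_mul, hN, (Nat.cast_commute p _).mul_pow, ← Nat.cast_pow, natCast_eq_zero_of_card hG,
    zero_mul]

/-- A nilpotent endomorphism kills an invariant subgroup of order dividing `p ^ k` after `k`
steps. -/
lemma AddMonoid.End.pow_apply_eq_zero_of_card_dvd {G : Type*} [AddCommGroup G] [Finite G] {p : ℕ}
    (hp : p.Prime) {N : AddMonoid.End G} (hN : IsNilpotent N) (k : ℕ) (B : AddSubgroup G)
    (hB : ∀ b ∈ B, N b ∈ B) (hcard : Nat.card B ∣ p ^ k) : ∀ b ∈ B, (N ^ k) b = 0 := by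
  induction k generalizing B with
  | zero =>
    intro b hb
    rw [pow_zero, Nat.dvd_one, AddSubgroup.card_eq_one] at hcard
    subst hcard
    exact AddSubgroup.mem_bot.mp hb
  | succ k ih =>
    have hle : B.map N ≤ B := by
      rintro _ ⟨b, hb, rfl⟩
      exact hB b hb
    have hinv : ∀ b ∈ B.map N, N b ∈ B.map N := fun b hb => ⟨b, hle hb, rfl⟩
    have hmap : Nat.card (B.map N) ∣ p ^ k := by
      obtain ⟨j, hj, hcj⟩ := (Nat.dvd_prime_pow hp).mp hcard
      obtain ⟨l, -, hcl⟩ := (Nat.dvd_prime_pow hp).mp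
        ((AddSubgroup.card_dvd_of_le hle).trans hcard)
      rcases hj.lt_or_eq with hj | rfl
      · exact (AddSubgroup.card_dvd_of_le hle).trans (hcj ▸ pow_dvd_pow p (by omega))
      · rw [hcl]
        apply pow_dvd_pow
        have hlj : p ^ l ≤ p ^ (k + 1) := by
          rw [← hcl, ← hcj]
          exact Nat.le_of_dvd Nat.card_pos (AddSubgroup.card_dvd_of_le hle)
        have hl := (Nat.pow_le_pow_iff_right hp.one_lt).mp hlj
        rcases hl.lt_or_eq with hl | rfl
        · omega
        exfalso
        have heq : B.map N = B := AddSubgroup.eq_of_le_of_card_ge hle (by rw [hcl, hcj])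
        have hall : ∀ n : ℕ, ∀ b ∈ B, ∃ c ∈ B, (N ^ n) c = b := by
          intro n
          induction n with
          | zero => exact fun b hb => ⟨b, hb, rfl⟩
          | succ n ihn =>
            intro b hb
            obtain ⟨c, hc, rfl⟩ := ihn b hb
            rw [← heq] at hc
            obtain ⟨d, hd, rfl⟩ := hc
            exact ⟨d, hd, by rw [pow_succ]; rfl⟩
        obtain ⟨n, hn⟩ := hN
        have hbot : B = ⊥ := by
          rw [AddSubgroup.eq_bot_iff_forall]
          intro b hb
          obtain ⟨c, -, rfl⟩ := hall n b hb
          rw [hn]; rfl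
        rw [hbot, AddSubgroup.card_bot] at hcj
        exact (Nat.one_lt_pow (Nat.succ_ne_zero k) hp.one_lt).ne hcj
    intro b hb
    rw [pow_succ]
    exact ih _ hinv hmap (N b) ⟨b, hb, rfl⟩

namespace Brace

variable {A : Type*} [Brace A]

lemma isNilpotent_starHom {p k : ℕ} (hp : p.Prime) (hA : Nat.card A = p ^ k) (a : A) :
    IsNilpotent (starHom a) := by
  refine AddMonoid.End.isNilpotent_sub_one_of_pow_eq_one hp hA (n := k) ?_
  rw [← lam_pow, ← hA, pow_card_eq_one', lam_one]

lemma starHom_pow_eq_zero {p k : ℕ} (hp : p.Prime) (hA : Nat.card A = p ^ k) (a : A) :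
    starHom a ^ k = 0 := by
  have : Finite A := Nat.finite_of_card_ne_zero (hA ▸ (pow_pos hp.pos k).ne')
  ext b
  exact AddMonoid.End.pow_apply_eq_zero_of_card_dvd hp (isNilpotent_starHom hp hA a) k ⊤
    (fun _ _ => trivial) (by rw [AddSubgroup.card_top, hA]) b trivial

lemma pow_eq_sum_choose {a : A} (h : starHom a ^ 4 = 0) (n : ℕ) :
    a ^ n = n • a + n.choose 2 • starHom a a + n.choose 3 • starHom a (starHom a a) +
      n.choose 4 • starHom a (starHom a (starHom a a)) := by
  have h4 : starHom a (starHom a (starHom a (starHom a a))) = 0 := DFunLike.congr_fun h a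
  induction n with
  | zero => simp [one_eq_zero]
  | succ n ih =>
    rw [pow_succ', mul_eq_add_starHom, ih]
    simp only [map_add, map_nsmul, h4, Nat.choose_succ_succ' n, Nat.choose_one_right, add_smul,
      one_smul, smul_zero, Nat.reduceAdd]
    abel

/-- For a prime `p > 4`, the `p ^ m`-th power differs from `p ^ m • a` by `p ^ m`-multiples
of iterated stars. -/
lemma exists_pow_prime_pow_eq {p m : ℕ} (hp : p.Prime) (hp4 : 4 < p) {a : A}
    (h : starHom a ^ 4 = 0) :
    ∃ c d e : ℕ, a ^ p ^ m = p ^ m • (a + c • starHom a a + d • starHom a (starHom a a) +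
      e • starHom a (starHom a (starHom a a))) := by
  have key : ∀ k, 0 < k → k < p → p ^ m ∣ (p ^ m).choose k := by
    intro k hk hkp
    have hc : Nat.Coprime (p ^ m) k :=
      Nat.Coprime.pow_left m ((Nat.Prime.coprime_iff_not_dvd hp).mpr (Nat.not_dvd_of_pos_of_lt hk hkp))
    obtain ⟨j, rfl⟩ := Nat.exists_eq_succ_of_ne_zero hk.ne'
    obtain ⟨q, hq⟩ := Nat.exists_eq_succ_of_ne_zero (pow_pos hp.pos m).ne'
    refine hc.dvd_of_dvd_mul_right ?_
    rw [hq, ← Nat.add_one_mul_choose_eq]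
    exact Dvd.intro _ rfl
  obtain ⟨c, hc⟩ := key 2 (by omega) (by omega)
  obtain ⟨d, hd⟩ := key 3 (by omega) (by omega)
  obtain ⟨e, he⟩ := key 4 (by omega) (by omega)
  refine ⟨c, d, e, ?_⟩
  rw [pow_eq_sum_choose h, hc, hd, he]
  simp only [smul_add, mul_smul]

/-- The additive subgroup `n • A`. -/
def nsmulSubgroup (A : Type*) [Brace A] (n : ℕ) : AddSubgroup A :=
  (nsmulAddMonoidHom n : A →+ A).range

lemma mem_nsmulSubgroup {n : ℕ} {x : A} : x ∈ nsmulSubgroup A n ↔ ∃ y : A, n • y = x := Iff.rfl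

lemma map_mem_nsmulSubgroup {n : ℕ} (f : AddMonoid.End A) {x : A} (hx : x ∈ nsmulSubgroup A n) :
    f x ∈ nsmulSubgroup A n := by
  obtain ⟨y, rfl⟩ := mem_nsmulSubgroup.mp hx
  exact mem_nsmulSubgroup.mpr ⟨f y, (map_nsmul f n y).symm⟩

/-- If `A` has additive group `C_p × C_{p^3}`, every star product is killed by `p ^ 2`. -/
lemma sq_smul_starHom_eq_zero {p : ℕ} (hp : p.Prime) (hA : Nat.card A = p ^ 4)
    (e : A ≃+ ZMod p × ZMod (p ^ 3)) (a b : A) : p ^ 2 • starHom a b = 0 := by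
  have : Finite A := Nat.finite_of_card_ne_zero (hA ▸ (pow_pos hp.pos 4).ne')
  let g : A := e.symm (0, ((p ^ 2 : ℕ) : ZMod (p ^ 3)))
  have hpg : p • g = 0 := by
    rw [← map_nsmul, Prod.smul_mk, smul_zero, nsmul_eq_mul, ← Nat.cast_mul, ← pow_succ',
      ZMod.natCast_self]
    exact map_zero _
  have hle : nsmulSubgroup A (p ^ 2) ≤ AddSubgroup.zmultiples g := by
    rintro _ ⟨y, rfl⟩
    refine AddSubgroup.mem_zmultiples_iff.mpr ⟨((e y).2.val : ℤ), ?_⟩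
    have : NeZero (p ^ 3) := ⟨(pow_pos hp.pos 3).ne'⟩
    apply e.injective
    rw [natCast_zsmul, map_nsmul, e.apply_symm_apply, nsmulAddMonoidHom_apply, map_nsmul]
    refine Prod.ext ?_ ?_
    · simp [pow_two]
    · simp [mul_comm]
  have hcard : Nat.card (nsmulSubgroup A (p ^ 2)) ∣ p ^ 1 := by
    refine (AddSubgroup.card_dvd_of_le hle).trans ?_
    rw [Nat.card_zmultiples, pow_one]
    exact addOrderOf_dvd_of_nsmul_eq_zero hpg
  rw [← map_nsmul, ← pow_one (starHom a)]
  exact AddMonoid.End.pow_apply_eq_zero_of_card_dvd hp (isNilpotent_starHom hp hA a) 1 _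
    (fun _ h => map_mem_nsmulSubgroup _ h) hcard _ ⟨b, rfl⟩

lemma mem_nsmulSubgroup_of_smul_eq_zero {p : ℕ} (hp : p.Prime)
    (e : A ≃+ ZMod (p ^ 2) × ZMod (p ^ 2)) {x : A} (hx : p • x = 0) : x ∈ nsmulSubgroup A p := by
  have : NeZero (p ^ 2) := ⟨(pow_pos hp.pos 2).ne'⟩
  have key : ∀ z : ZMod (p ^ 2), p • z = 0 → ∃ w : ZMod (p ^ 2), p • w = z := by
    intro z hz
    have hd : p * p ∣ p * z.val := by
      rw [← pow_two p, ← ZMod.natCast_eq_zero_iff, Nat.cast_mul, ZMod.natCast_zmod_val, ← nsmul_eq_mul, hz]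
    obtain ⟨w, hw⟩ := Nat.dvd_of_mul_dvd_mul_left hp.pos hd
    refine ⟨w, ?_⟩
    rw [nsmul_eq_mul, ← Nat.cast_mul, ← hw, ZMod.natCast_zmod_val]
  have he : p • e x = 0 := by rw [← map_nsmul, hx, map_zero]
  obtain ⟨w₁, h₁⟩ := key (e x).1 (congrArg Prod.fst he)
  obtain ⟨w₂, h₂⟩ := key (e x).2 (congrArg Prod.snd he)
  refine mem_nsmulSubgroup.mpr ⟨e.symm (w₁, w₂), ?_⟩
  rw [← map_nsmul, Prod.smul_mk, h₁, h₂, e.symm_apply_apply]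

lemma card_nsmulSubgroup {p : ℕ} (hp : p.Prime) (hA : Nat.card A = p ^ 4)
    (e : A ≃+ ZMod (p ^ 2) × ZMod (p ^ 2)) : Nat.card (nsmulSubgroup A p) = p ^ 2 := by
  have hker : (nsmulAddMonoidHom p : A →+ A).ker = nsmulSubgroup A p := by
    ext x
    rw [AddMonoidHom.mem_ker, nsmulAddMonoidHom_apply]
    refine ⟨mem_nsmulSubgroup_of_smul_eq_zero hp e, ?_⟩
    rintro ⟨y, rfl⟩
    apply e.injective
    rw [nsmulAddMonoidHom_apply, ← mul_smul, ← pow_two, map_nsmul, map_zero]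
    refine Prod.ext ?_ ?_
    · rw [Prod.smul_fst, nsmul_eq_mul, ZMod.natCast_self, zero_mul, Prod.fst_zero]
    · rw [Prod.smul_snd, nsmul_eq_mul, ZMod.natCast_self, zero_mul, Prod.snd_zero]
  have h := (nsmulAddMonoidHom p : A →+ A).ker.card_mul_index
  rw [AddSubgroup.index_ker, hker, hA] at h
  change Nat.card (nsmulSubgroup A p) * Nat.card (nsmulSubgroup A p) = p ^ 4 at h
  apply Nat.pow_left_injective (n := 2) two_ne_zero
  change _ ^ 2 = (p ^ 2) ^ 2
  rw [pow_two, h, ← pow_mul]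

/-- In additive type `C_{p^2} × C_{p^2}`, elements of `∘`-order dividing `p` lie in `p • A`. -/
lemma mem_nsmulSubgroup_of_pow_eq_one {p : ℕ} (hp : p.Prime) (hp4 : 4 < p)
    (hA : Nat.card A = p ^ 4) (e : A ≃+ ZMod (p ^ 2) × ZMod (p ^ 2)) {a : A} (ha : a ^ p = 1) :
    a ∈ nsmulSubgroup A p := by
  have : Finite A := Nat.finite_of_card_ne_zero (hA ▸ (pow_pos hp.pos 4).ne')
  have hsq : ∀ b : A, p • starHom a (starHom a b) = 0 := by
    intro b
    have h := AddMonoid.End.pow_apply_eq_zero_of_card_dvd hp (isNilpotent_starHom hp hA a) 2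
      (nsmulSubgroup A p) (fun _ h => map_mem_nsmulSubgroup _ h)
      (card_nsmulSubgroup hp hA e).dvd (p • b) ⟨b, rfl⟩
    rwa [map_nsmul] at h
  obtain ⟨c, d, f, h⟩ := exists_pow_prime_pow_eq (m := 1) hp hp4 (starHom_pow_eq_zero hp hA a)
  rw [pow_one, ha, one_eq_zero] at h
  simp only [smul_add, smul_comm p, hsq, smul_zero, add_zero] at h
  have h1 := congrArg (starHom a) h
  rw [map_zero, map_add, map_nsmul, map_nsmul, map_nsmul, hsq, smul_zero, add_zero] at h1
  rw [← h1, smul_zero, add_zero] at h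
  exact mem_nsmulSubgroup_of_smul_eq_zero hp e h.symm

end Brace

/-- Additive type `C_{p^2} × C_{p^2}` with `m = 1` cannot occur in Setup (T). -/
lemma SetupT.isEmpty_addEquiv_of_one {p i : ℕ} {A : Type*} [Brace A] {P : A} {Q : Fin i → A}
    (h : SetupT p 1 i A P Q) : IsEmpty (A ≃+ ZMod (p ^ 2) × ZMod (p ^ 2)) := by
  refine ⟨fun e => ?_⟩
  have hp := h.hp
  have hp4 : 4 < p := by have := h.hp5; omega
  let H : Subgroup A := Brace.subgroupOfLamInvariant (Brace.nsmulSubgroup A p)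
    (fun a _ hb => Brace.map_mem_nsmulSubgroup _ hb)
  have hPH : P ^ p ∈ H := by
    obtain ⟨c, d, f, h⟩ := Brace.exists_pow_prime_pow_eq (m := 1) hp hp4
      (Brace.starHom_pow_eq_zero hp h.hcard P)
    rw [pow_one] at h
    exact ⟨_, h.symm⟩
  have hQH : ∀ j, Q j ∈ H := by
    intro j
    apply Brace.mem_nsmulSubgroup_of_pow_eq_one hp hp4 h.hcard e
    obtain ⟨l, -, hl⟩ := (Nat.dvd_prime_pow hp).mp (h.hcard ▸ orderOf_dvd_natCard (Q j))
    have hle := h.hord j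
    rw [hl, Nat.pow_le_pow_iff_right hp.one_lt] at hle
    apply orderOf_dvd_iff_pow_eq_one.mp
    rw [hl]
    exact (pow_dvd_pow p hle).trans (pow_one p).dvd
  have hsurj : Function.Surjective (fun k : Fin p => (QuotientGroup.mk (P ^ (k : ℕ)) : A ⧸ H)) := by
    intro x
    obtain ⟨a, rfl⟩ := QuotientGroup.mk_surjective x
    obtain ⟨k, f, rfl⟩ := h.hdecomp a 1
    have hp0 : (0 : ℤ) < p := by exact_mod_cast hp.pos
    have hk0 := Int.emod_nonneg k hp0.ne'
    have hkp := Int.emod_lt_of_pos k hp0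
    refine ⟨⟨(k % p).toNat, by omega⟩, ?_⟩
    refine QuotientGroup.eq.mpr ?_
    have hk : (P ^ (k % p).toNat)⁻¹ * P ^ k = (P ^ p) ^ (k / p) := by
      rw [← zpow_natCast, ← zpow_natCast P p, Int.toNat_of_nonneg hk0, ← zpow_mul, ← zpow_neg,
        ← zpow_add]
      congr 1
      have := Int.emod_add_mul_ediv k p
      omega
    rw [← mul_assoc]
    refine H.mul_mem (hk ▸ H.zpow_mem hPH _) (H.list_prod_mem ?_)
    intro x hx
    obtain ⟨t, rfl⟩ := List.mem_ofFn.mp hx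
    exact H.zpow_mem (hQH _) _
  have hindex : Nat.card (A ⧸ H) ≤ p := by
    simpa using Nat.card_le_card_of_surjective _ hsurj
  have hmul := H.card_mul_index
  have hH : Nat.card H = p ^ 2 := Brace.card_nsmulSubgroup hp h.hcard e
  change _ * Nat.card (A ⧸ H) = _ at hmul
  rw [hH, h.hcard] at hmul
  have h1 : p ^ 4 ≤ p ^ 3 := by
    rw [← hmul, pow_succ p 2]
    exact Nat.mul_le_mul_left _ hindex
  have := (Nat.pow_le_pow_iff_right hp.one_lt).mp h1
  omega

/-- under Setup (T), p^m·(P∗(P∗P^n)) = n·p^m·(P∗(P∗P)) = 0 for all n ∈ ℤ,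
and P^{p^m} = p^m·P. -/
theorem setupT_pm_star_star_pow (p m i : ℕ) (A : Type*) [Brace A]
    (P : A) (Q : Fin i → A) (h : SetupT p m i A P Q) :
    (∀ n : ℤ,
      ((p ^ m : ℤ)) • Brace.bstar P (Brace.bstar P (P ^ n)) =
        (n * (p ^ m : ℤ)) • Brace.bstar P (Brace.bstar P P) ∧
      (n * (p ^ m : ℤ)) • Brace.bstar P (Brace.bstar P P) = 0) ∧
    P ^ (p ^ m) = (p ^ m) • P := by
  rcases h.hadd with ⟨⟨e⟩, rfl⟩ | ⟨⟨e⟩, rfl⟩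
  · have hz : ∀ b : A, p ^ 2 • Brace.bstar P b = 0 :=
      fun b => Brace.sq_smul_starHom_eq_zero h.hp h.hcard e P b
    have hz' : ∀ b : A, (p ^ 2 : ℤ) • Brace.bstar P b = 0 := by
      intro b
      rw [← hz b, ← natCast_zsmul, Nat.cast_pow]
    refine ⟨fun n => ⟨?_, ?_⟩, ?_⟩
    · rw [hz', mul_smul, hz', smul_zero]
    · rw [mul_smul, hz', smul_zero]
    · have hp5 := h.hp5
      obtain ⟨c, d, f, hP⟩ := Brace.exists_pow_prime_pow_eq (m := 2) h.hp (by omega)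
        (Brace.starHom_pow_eq_zero h.hp h.hcard P)
      rw [hP]
      simp only [smul_add, smul_comm (p ^ 2), Brace.starHom_apply, hz, smul_zero, add_zero]
  · exact (h.isEmpty_addEquiv_of_one.false e).elim
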